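/- arXiv:1812.11761 — 2 statements merged into one kernel-verified Lean document; each statement's English description precedes it below -/
import Mathlib

section
/- Let z, w, c in C^{n+1} (C the complex numbers) with the signature (n,1) Hermitian form, with <c,c> a nonzero real number and <z,c> = 0, and set p := w - (<w,c>/<c,c>) * c. Then the Hermitian triple product satisfies <z,w,p> = <p,p> * |<z,w>|^2; in particular <z,w,p> is real. (This is the complex-hyperbolic version of the projection computation used in Goldman's argument for the tightness of the embedding of a complex line into complex hyperbolic n-space.) -/
open Finset Complex

/-- The Hermitian form of signature (n,1) on ℂ^{n+1}:
    ⟪z,w⟫ = ∑_{i=1}^n conj(w_i) z_i - conj(w_{n+1}) z_{n+1}. -/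
noncomputable def hermC {n : ℕ} (z w : Fin (n + 1) → ℂ) : ℂ :=
  (∑ i : Fin n, star (w i.castSucc) * z i.castSucc) - star (w (Fin.last n)) * z (Fin.last n)

/-- The Hermitian triple product ⟪v,w,z⟫ = ⟪v,w⟫⟪w,z⟫⟪z,v⟫. -/
noncomputable def tripleC {n : ℕ} (v w z : Fin (n + 1) → ℂ) : ℂ :=
  hermC v w * hermC w z * hermC z v

/-- A complex number is real if it lies in the real subfield of ℂ. -/
def IsRealC (q : ℂ) : Prop := ∃ r : ℝ, q = (r : ℂ)

/-- A vector is negative if ⟪v,v⟫ < 0 (note ⟪v,v⟫ is always real). -/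
noncomputable def IsNegVecC {n : ℕ} (v : Fin (n + 1) → ℂ) : Prop :=
  ∃ r : ℝ, r < 0 ∧ hermC v v = (r : ℂ)

theorem hermC_sub_mul_left {n : ℕ} (x y v : Fin (n + 1) → ℂ) (k : ℂ) :
    hermC (fun i => x i - k * y i) v = hermC x v - k * hermC y v := by
  simp only [hermC, mul_sub, Finset.sum_sub_distrib, Finset.mul_sum, mul_left_comm k]
  ring

theorem star_hermC {n : ℕ} (x y : Fin (n + 1) → ℂ) : star (hermC x y) = hermC y x := by
  simp only [hermC, star_sub, star_sum, star_mul', star_star, mul_comm]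

theorem isRealC_hermC_self {n : ℕ} (x : Fin (n + 1) → ℂ) : IsRealC (hermC x x) :=
  Complex.conj_eq_iff_real.1 (star_hermC x x)

theorem hermC_proj_left {n : ℕ} (w : Fin (n + 1) → ℂ) {c : Fin (n + 1) → ℂ}
    (hc : hermC c c ≠ 0) :
    hermC (fun i => w i - (hermC w c / hermC c c) * c i) c = 0 := by
  rw [hermC_sub_mul_left, div_mul_cancel₀ _ hc, sub_self]

/-- Complex-hyperbolic projection computation: if ⟪z,c⟫ = 0 and
    p = w - (⟪w,c⟫/⟪c,c⟫)·c, then ⟪z,w,p⟫ = ⟪p,p⟫|⟪z,w⟫|²; in particular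
    ⟪z,w,p⟫ is real. -/
theorem tripleC_proj_real (n : ℕ) (z w c : Fin (n + 1) → ℂ)
    (hc : ∃ r : ℝ, r ≠ 0 ∧ hermC c c = (r : ℂ)) (hzc : hermC z c = 0) :
    tripleC z w (fun i => w i - (hermC w c / hermC c c) * c i) =
        hermC (fun i => w i - (hermC w c / hermC c c) * c i)
          (fun i => w i - (hermC w c / hermC c c) * c i) *
          (hermC z w * star (hermC z w)) ∧
      IsRealC (tripleC z w (fun i => w i - (hermC w c / hermC c c) * c i)) := by
  have hcc : hermC c c ≠ 0 := by
    obtain ⟨r, hr, h⟩ := hc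
    rw [h]
    exact_mod_cast hr
  have hpc := hermC_proj_left w hcc
  set k := hermC w c / hermC c c
  set p : Fin (n + 1) → ℂ := fun i => w i - k * c i with hp
  have hcp : hermC c p = 0 := by rw [← star_hermC, hpc, star_zero]
  have hcz : hermC c z = 0 := by rw [← star_hermC, hzc, star_zero]
  have hpv (v : Fin (n + 1) → ℂ) (hv : hermC c v = 0) : hermC p v = hermC w v := by
    rw [hp, hermC_sub_mul_left, hv, mul_zero, sub_zero]
  have key : tripleC z w p = hermC p p * (hermC z w * star (hermC z w)) := by
    rw [tripleC, hpv p hcp, hpv z hcz, star_hermC]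
    ring
  refine ⟨key, ?_⟩
  obtain ⟨r, hr⟩ := isRealC_hermC_self p
  refine ⟨r * Complex.normSq (hermC z w), ?_⟩
  rw [key, hr, Complex.ofReal_mul, ← Complex.mul_conj]
  rfl
end

section
/- Let v, w, z in C^{n+1} (C the complex numbers) be negative vectors for the signature (n,1) Hermitian form (i.e. <v,v> < 0, <w,w> < 0, <z,z> < 0). Then the Hermitian triple product <v,w,z> is real if and only if there exist nonzero complex numbers lam0, lam1, lam2 such that the three pairwise Hermitian products <lam0*v, lam1*w>, <lam1*w, lam2*z>, <lam2*z, lam0*v> are all real, i.e. if and only if the corresponding three points of complex hyperbolic n-space are contained in a totally real subspace. -/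
open Finset Complex

lemma hermC_smul_smul {n : ℕ} (a b : ℂ) (z w : Fin (n + 1) → ℂ) :
    hermC (fun i => a * z i) (fun i => b * w i) = a * star b * hermC z w := by
  simp only [hermC, star_mul', mul_sub, Finset.mul_sum]
  congr 1
  · exact Finset.sum_congr rfl fun i _ => by ring
  · ring

lemma isRealC_iff_star_eq (q : ℂ) : IsRealC q ↔ star q = q :=
  Complex.conj_eq_iff_real.symm

lemma IsRealC.mul {p q : ℂ} (hp : IsRealC p) (hq : IsRealC q) : IsRealC (p * q) := by
  rw [isRealC_iff_star_eq] at *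
  rw [star_mul', hp, hq]

lemma isRealC_mul_star_self (q : ℂ) : IsRealC (q * star q) := by
  rw [isRealC_iff_star_eq, star_mul', star_star, mul_comm]

lemma isRealC_zero : IsRealC 0 := ⟨0, by simp⟩

/-- Multiplying by a nonzero real number does not affect whether a complex number is real. -/
lemma IsRealC.of_mul_left {p q : ℂ} (hp : IsRealC p) (hp0 : p ≠ 0) (h : IsRealC (p * q)) :
    IsRealC q := by
  rw [isRealC_iff_star_eq] at *
  rw [star_mul', hp] at h
  exact mul_left_cancel₀ hp0 h

lemma exists_ne_zero_isRealC_mul (x : ℂ) : ∃ u : ℂ, u ≠ 0 ∧ IsRealC (u * x) := by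
  by_cases hx : x = 0
  · exact ⟨1, one_ne_zero, by simpa [hx] using isRealC_zero⟩
  · exact ⟨star x, star_ne_zero.2 hx, by simpa [mul_comm] using isRealC_mul_star_self x⟩

lemma exists_ne_zero_isRealC_star_mul (x : ℂ) : ∃ u : ℂ, u ≠ 0 ∧ IsRealC (star u * x) := by
  obtain ⟨u, hu, h⟩ := exists_ne_zero_isRealC_mul x
  exact ⟨star u, star_ne_zero.2 hu, by rwa [star_star]⟩

/-- A product of three complex numbers is real iff a change of phases at the vertices of a triangle
makes all three of its factors, placed on the edges, real. -/
lemma isRealC_mul_mul_iff (a b c : ℂ) :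
    IsRealC (a * b * c) ↔
      ∃ x y t : ℂ, x ≠ 0 ∧ y ≠ 0 ∧ t ≠ 0 ∧
        IsRealC (x * star y * a) ∧ IsRealC (y * star t * b) ∧ IsRealC (t * star x * c) := by
  constructor
  · intro h
    by_cases hb : b = 0
    · obtain ⟨x, hx, hxa⟩ := exists_ne_zero_isRealC_mul a
      obtain ⟨t, ht, htc⟩ := exists_ne_zero_isRealC_mul (star x * c)
      exact ⟨x, 1, t, hx, one_ne_zero, ht, by simpa using hxa, by simpa [hb] using isRealC_zero,
        by rwa [mul_assoc]⟩
    by_cases hc : c = 0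
    · obtain ⟨x, hx, hxa⟩ := exists_ne_zero_isRealC_mul a
      obtain ⟨t, ht, htb⟩ := exists_ne_zero_isRealC_star_mul b
      exact ⟨x, 1, t, hx, one_ne_zero, ht, by simpa using hxa, by simpa using htb,
        by simpa [hc] using isRealC_zero⟩
    · refine ⟨b * c, 1, b, mul_ne_zero hb hc, one_ne_zero, hb, ?_, ?_, ?_⟩
      · convert h using 1
        rw [star_one]
        ring
      · convert isRealC_mul_star_self b using 1
        ring
      · convert isRealC_mul_star_self (b * c) using 1
        ring
  · rintro ⟨x, y, t, hx, hy, ht, ha, hb, hc⟩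
    refine (isRealC_mul_star_self (x * y * t)).of_mul_left ?_ ?_
    · have h := mul_ne_zero (mul_ne_zero hx hy) ht
      exact mul_ne_zero h (star_ne_zero.2 h)
    · convert (ha.mul hb).mul hc using 1
      simp only [star_mul']
      ring

/-- For negative vectors v, w, z in ℂ^{n+1}, the Hermitian triple product ⟪v,w,z⟫
    is real iff some nonzero rescalings λ₀v, λ₁w, λ₂z have all three pairwise
    Hermitian products real, i.e. iff the corresponding three points of complex
    hyperbolic n-space lie in a totally real subspace. -/
theorem tripleC_real_iff_totally_real (n : ℕ) (v w z : Fin (n + 1) → ℂ)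
    (hv : IsNegVecC v) (hw : IsNegVecC w) (hz : IsNegVecC z) :
    IsRealC (tripleC v w z) ↔
      ∃ lam0 lam1 lam2 : ℂ, lam0 ≠ 0 ∧ lam1 ≠ 0 ∧ lam2 ≠ 0 ∧
        IsRealC (hermC (fun i => lam0 * v i) (fun i => lam1 * w i)) ∧
        IsRealC (hermC (fun i => lam1 * w i) (fun i => lam2 * z i)) ∧
        IsRealC (hermC (fun i => lam2 * z i) (fun i => lam0 * v i)) := by
  simp only [hermC_smul_smul]
  exact isRealC_mul_mul_iff _ _ _
end
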